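/- arXiv:2105.02990 — 12 statements merged into one kernel-verified Lean document; each statement's English description precedes it below -/
import Mathlib

section
/- Let S be an affine semigroup, i.e., a finitely generated additive submonoid of ℤ^n, and let D be a homogeneous derivation on the semigroup algebra ℂ[S], i.e., a ℂ-derivation such that for every a ∈ S there exist b ∈ S and c ∈ ℂ with D(χ^a) = c·χ^b. Then there exists a single element e ∈ ℤ^n such that for every a ∈ S with D(χ^a) ≠ 0 there are b ∈ S and c ∈ ℂ with D(χ^a) = c·χ^b and b = a + e in ℤ^n. -/
/-- If a sum of two monomials with nonzero coefficients is a monomial, then the two monomials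
have the same exponent. -/
theorem eq_of_single_add_single_eq_single {G R : Type*} [AddMonoid R] {x y z : G} {c d r : R}
    (hc : c ≠ 0) (hd : d ≠ 0)
    (h : Finsupp.single x c + Finsupp.single y d = Finsupp.single z r) : x = y := by
  classical
  by_contra hxy
  have hx := DFunLike.congr_fun h x
  have hy := DFunLike.congr_fun h y
  simp only [Finsupp.add_apply, Finsupp.single_apply] at hx hy
  grind

/-- If a derivation maps `χ^a`, `χ^a'` and `χ^(a + a')` to multiples of monomials, the first two
nonzero, then it shifts `a` and `a'` by the same amount. -/
theorem Derivation.add_eq_add_of_map_single {R A : Type*} [CommRing R] [AddCommMonoid A]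
    (D : Derivation R (AddMonoidAlgebra R A) (AddMonoidAlgebra R A))
    {a a' b b' b'' : A} {c c' c'' : R} (hc : c ≠ 0) (hc' : c' ≠ 0)
    (h : D (AddMonoidAlgebra.single a 1) = c • AddMonoidAlgebra.single b 1)
    (h' : D (AddMonoidAlgebra.single a' 1) = c' • AddMonoidAlgebra.single b' 1)
    (h'' : D (AddMonoidAlgebra.single (a + a') 1) = c'' • AddMonoidAlgebra.single b'' 1) :
    a + b' = a' + b := by
  have key := D.leibniz (AddMonoidAlgebra.single a 1) (AddMonoidAlgebra.single a' 1)
  rw [AddMonoidAlgebra.single_mul_single, one_mul, h, h', h''] at key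
  simp only [smul_eq_mul, AddMonoidAlgebra.smul_single, AddMonoidAlgebra.single_mul_single,
    one_mul, mul_one] at key
  exact eq_of_single_add_single_eq_single hc' hc (congrArg AddMonoidAlgebra.coeff key.symm)

/-- For a homogeneous derivation `D` on `ℂ[S]` (every `D(χ^a)` is a scalar
multiple of a single monomial), there is a single `e ∈ ℤ^n` such that whenever
`D(χ^a) ≠ 0`, the monomial appearing in `D(χ^a)` has exponent `a + e`. -/
theorem stmt_0 {n : ℕ} (S : AddSubmonoid (Fin n → ℤ)) (hfg : S.FG)
    (D : Derivation ℂ (AddMonoidAlgebra ℂ S) (AddMonoidAlgebra ℂ S))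
    (hhom : ∀ a : S, ∃ (b : S) (c : ℂ),
      D (AddMonoidAlgebra.single a 1) = c • AddMonoidAlgebra.single b 1) :
    ∃ e : Fin n → ℤ, ∀ a : S, D (AddMonoidAlgebra.single a 1) ≠ 0 →
      ∃ (b : S) (c : ℂ),
        D (AddMonoidAlgebra.single a 1) = c • AddMonoidAlgebra.single b 1 ∧
        (b : Fin n → ℤ) = (a : Fin n → ℤ) + e := by
  by_cases h : ∃ a₀ : S, D (AddMonoidAlgebra.single a₀ 1) ≠ 0
  · obtain ⟨a₀, ha₀⟩ := h
    obtain ⟨b₀, c₀, h₀⟩ := hhom a₀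
    refine ⟨b₀ - a₀, fun a ha => ?_⟩
    obtain ⟨b, c, hbc⟩ := hhom a
    obtain ⟨b', c', hbc'⟩ := hhom (a + a₀)
    refine ⟨b, c, hbc, ?_⟩
    have hc : c ≠ 0 := by
      rintro rfl
      exact ha (by rw [hbc, zero_smul])
    have hc₀ : c₀ ≠ 0 := by
      rintro rfl
      exact ha₀ (by rw [h₀, zero_smul])
    have key := congrArg (Subtype.val : S → Fin n → ℤ)
      (D.add_eq_add_of_map_single hc hc₀ hbc h₀ hbc')
    simp only [AddSubmonoid.coe_add] at key
    rw [← add_sub_assoc, key, add_sub_cancel_left]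
  · push Not at h
    exact ⟨0, fun a ha => absurd (h a) ha⟩
end

section
/- Let S be an affine semigroup, i.e., a finitely generated additive submonoid of ℤ^n. Then S is pointed (a + b = 0 implies a = 0 and b = 0 for a, b ∈ S) if and only if for every a ∈ S the set of pairs {(b, c) ∈ S × S : b + c = a} is finite. -/
/-- **Dickson's lemma** for finitely generated commutative monoids: the algebraic preorder is a
well quasi-order. -/
theorem AddMonoid.FG.wellQuasiOrdered_exists_add {M : Type*} [AddCommMonoid M]
    (h : AddMonoid.FG M) : WellQuasiOrdered fun a b : M ↦ ∃ c, b = a + c := by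
  obtain ⟨s, hs⟩ := h.fg_top
  have hsurj (a : M) : ∃ u : s → ℕ, a = ∑ i, u i • (i : M) := by
    have ha : a ∈ AddSubmonoid.closure (Set.range ((↑) : s → M)) := by
      simp [hs]
    exact AddSubmonoid.mem_closure_range_iff_of_fintype.mp ha
  choose u hu using hsurj
  intro f
  obtain ⟨i, j, hij, hle⟩ := wellQuasiOrdered_le fun k ↦ u (f k)
  refine ⟨i, j, hij, ∑ k, (u (f j) - u (f i)) k • (k : M), ?_⟩
  calc
    f j = ∑ k, u (f j) k • (k : M) := hu (f j)
    _ = ∑ k, u (f i) k • (k : M) + ∑ k, (u (f j) - u (f i)) k • (k : M) := by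
      rw [← Finset.sum_add_distrib]
      refine Finset.sum_congr rfl fun k _ ↦ ?_
      rw [← add_nsmul, Pi.sub_apply, Nat.add_sub_cancel' (hle k)]
    _ = f i + ∑ k, (u (f j) - u (f i)) k • (k : M) := by rw [← hu (f i)]

theorem AddMonoid.FG.finite_setOf_add_eq {M : Type*} [AddCommMonoid M] [IsCancelAdd M]
    (h : AddMonoid.FG M) (hM : ∀ a b : M, a + b = 0 → a = 0 ∧ b = 0) (a : M) :
    {p : M × M | p.1 + p.2 = a}.Finite := by
  by_contra hinf
  let f := Set.Infinite.natEmbedding _ hinf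
  obtain ⟨i, j, hij, ⟨c, d⟩, hcd⟩ :=
    (inferInstance : AddMonoid.FG (M × M)).wellQuasiOrdered_exists_add fun k ↦ (f k : M × M)
  obtain ⟨hc, hd⟩ := Prod.ext_iff.mp hcd
  dsimp only [Prod.fst_add, Prod.snd_add] at hc hd
  have hi : (f i : M × M).1 + (f i : M × M).2 = a := (f i).2
  have hj : (f j : M × M).1 + (f j : M × M).2 = a := (f j).2
  have hzero : c + d = 0 := by
    rw [hc, hd, add_add_add_comm, hi] at hj
    exact add_eq_left.mp hj
  obtain ⟨rfl, rfl⟩ := hM c d hzero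
  refine hij.ne (f.injective (Subtype.ext (Prod.ext ?_ ?_)))
  · simpa using hc.symm
  · simpa using hd.symm

theorem eq_zero_of_add_eq_zero_of_finite {M : Type*} [AddCommMonoid M] [IsAddTorsionFree M]
    (hfin : {p : M × M | p.1 + p.2 = 0}.Finite) {a b : M} (hab : a + b = 0) : a = 0 := by
  by_contra ha
  refine Set.infinite_of_injective_forall_mem (f := fun k : ℕ ↦ (k • a, k • b)) ?_ ?_ hfin
  · refine Function.Injective.of_lt_imp_ne fun k l hkl h ↦ ha ?_
    have hka : k • a = l • a := congrArg Prod.fst h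
    have hl : (l - k) • a = 0 := by
      calc
        (l - k) • a = (l - k) • a + k • (a + b) := by rw [hab, nsmul_zero, add_zero]
        _ = l • a + k • b := by
          rw [nsmul_add, ← add_assoc, ← add_nsmul, Nat.sub_add_cancel hkl.le]
        _ = 0 := by rw [← hka, ← nsmul_add, hab, nsmul_zero]
    exact (nsmul_eq_zero_iff_right (Nat.sub_ne_zero_of_lt hkl)).mp hl
  · intro k
    simp [← nsmul_add, hab]

/-- An affine semigroup `S ⊆ ℤ^n` is pointed (`a + b = 0 → a = 0 ∧ b = 0`)
iff for every `a ∈ S` the set of pairs `(b, c) ∈ S × S` with `b + c = a` is finite. -/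
theorem stmt_2 {n : ℕ} (S : AddSubmonoid (Fin n → ℤ)) (hfg : S.FG) :
    (∀ a b : S, a + b = 0 → a = 0 ∧ b = 0) ↔
      ∀ a : S, {p : S × S | p.1 + p.2 = a}.Finite := by
  have : IsAddTorsionFree S := Subtype.val_injective.isAddTorsionFree S.subtype
  refine ⟨((AddMonoid.fg_iff_addSubmonoid_fg S).mpr hfg).finite_setOf_add_eq, fun h a b hab ↦ ?_⟩
  exact ⟨eq_zero_of_add_eq_zero_of_finite (h 0) hab,
    eq_zero_of_add_eq_zero_of_finite (h 0) ((add_comm b a).trans hab)⟩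
end

section
/- Let S be an affine semigroup endowed with the discrete topology, and let S_∞ = S ∪ {∞} be its one-point compactification, with addition extending that of S by x + ∞ = ∞ + x = ∞. Then the addition map S_∞ × S_∞ → S_∞ is continuous (i.e., S_∞ is a topological semigroup) if and only if S is pointed, i.e., a + b = 0 implies a = 0 and b = 0 for a, b ∈ S. -/
/-- The one-point compactification topology on `S_∞ = S ∪ {∞}` when `S` carries the
discrete topology: a set `U` is open iff either `U ⊆ S` (i.e. `⊤ ∉ U`), or `∞ ∈ U` and
its complement is a finite subset of `S`. -/
def onePointCompactTopology {n : ℕ} (S : AddSubmonoid (Fin n → ℤ)) :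
    TopologicalSpace (WithTop S) where
  IsOpen U := (⊤ : WithTop S) ∈ U → Uᶜ.Finite
  isOpen_univ := by intro _; simp
  isOpen_inter := by
    intro U V hU hV h
    rw [Set.compl_inter]
    exact (hU h.1).union (hV h.2)
  isOpen_sUnion := by
    intro s hs h
    rw [Set.mem_sUnion] at h
    obtain ⟨U, hUs, hU⟩ := h
    exact ((hs U hUs) hU).subset (Set.compl_subset_compl.mpr (Set.subset_sUnion_of_mem hUs))

/-- In a finitely generated commutative monoid which is cancellative and pointed, every element
has only finitely many decompositions as a sum of two elements. -/
theorem finite_setOf_add_eq_of_pointed {M : Type*} [AddCommMonoid M] [IsCancelAdd M] [AddMonoid.FG M]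
    (h : ∀ a b : M, a + b = 0 → a = 0 ∧ b = 0) (c : M) :
    {p : M × M | p.1 + p.2 = c}.Finite := by
  have : Module.Finite ℕ M := Module.Finite.iff_addMonoid_fg.mpr inferInstance
  obtain ⟨k, f, hf⟩ := Module.Finite.exists_fin' ℕ M
  by_contra hinf
  let e := Set.Infinite.natEmbedding _ hinf
  choose g hg using hf
  obtain ⟨i, j, hij, hle⟩ := wellQuasiOrdered_le (α := (Fin k → ℕ) × (Fin k → ℕ))
    fun i => (g (e i).1.1, g (e i).1.2)
  obtain ⟨x, hx⟩ := exists_add_of_le hle.1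
  obtain ⟨y, hy⟩ := exists_add_of_le hle.2
  dsimp only at hx hy
  have hx' : (e j).1.1 = (e i).1.1 + f x := by rw [← hg (e j).1.1, hx, map_add, hg]
  have hy' : (e j).1.2 = (e i).1.2 + f y := by rw [← hg (e j).1.2, hy, map_add, hg]
  have hi : (e i).1.1 + (e i).1.2 = c := (e i).2
  have hj : (e j).1.1 + (e j).1.2 = c := (e j).2
  have hxy : f x + f y = 0 := by
    rw [hx', hy', add_add_add_comm, hi] at hj
    exact add_eq_left.mp hj
  obtain ⟨h₁, h₂⟩ := h _ _ hxy
  rw [h₁, add_zero] at hx'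
  rw [h₂, add_zero] at hy'
  exact hij.ne' (e.injective (Subtype.ext (Prod.ext hx' hy')))

/-- If every element has only finitely many decompositions as a sum of two elements, then addition
on the one-point compactification is continuous. -/
theorem continuous_add_onePointCompact {n : ℕ} (S : AddSubmonoid (Fin n → ℤ))
    (h : ∀ c : S, {p : S × S | p.1 + p.2 = c}.Finite) :
    @Continuous _ _
      (@instTopologicalSpaceProd _ _ (onePointCompactTopology S) (onePointCompactTopology S))
      (onePointCompactTopology S)
      (fun p : WithTop S × WithTop S => p.1 + p.2) := by
  let _ := onePointCompactTopology S
  refine continuous_def.mpr fun U hU => isOpen_prod_iff.mpr fun a b hab => ?_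
  have key (hU' : ⊤ ∈ U) : ∃ V : Set (WithTop S), IsOpen V ∧ ⊤ ∈ V ∧
      ∀ x ∈ V, ∀ y, x + y ∈ U ∧ y + x ∈ U := by
    have hF : (⋃ c ∈ ((↑) : S → WithTop S) ⁻¹' Uᶜ, {p : S × S | p.1 + p.2 = c}).Finite :=
      ((hU hU').preimage WithTop.coe_injective.injOn).biUnion fun c _ => h c
    refine ⟨((fun p : S × S => (p.1 : WithTop S)) ''
      ⋃ c ∈ ((↑) : S → WithTop S) ⁻¹' Uᶜ, {p : S × S | p.1 + p.2 = c})ᶜ, fun _ => ?_, ?_, fun x hx y => ?_⟩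
    · rw [compl_compl]
      exact hF.image _
    · rintro ⟨p, -, hp⟩
      exact WithTop.coe_ne_top hp
    · rw [add_comm y x, and_self]
      by_contra hxy
      induction x with
      | top => exact hxy (by simpa using hU')
      | coe x =>
        induction y with
        | top => exact hxy (by simpa using hU')
        | coe y => exact hx ⟨(x, y), Set.mem_biUnion (x := x + y) hxy rfl, rfl⟩
  induction a with
  | top =>
    obtain ⟨V, hV, hmem, hsub⟩ := key (by simpa using hab)
    exact ⟨V, Set.univ, hV, isOpen_univ, hmem, trivial, fun p hp => (hsub _ hp.1 _).1⟩
  | coe a =>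
    induction b with
    | top =>
      obtain ⟨V, hV, hmem, hsub⟩ := key (by simpa using hab)
      exact ⟨Set.univ, V, isOpen_univ, hV, trivial, hmem, fun p hp => (hsub _ hp.2 _).2⟩
    | coe b =>
      refine ⟨{(a : WithTop S)}, {(b : WithTop S)}, fun h' => ?_, fun h' => ?_, rfl, rfl, ?_⟩
      · exact absurd h' WithTop.top_ne_coe
      · exact absurd h' WithTop.top_ne_coe
      · rintro ⟨x, y⟩ ⟨rfl, rfl⟩
        exact hab

/-- If addition on the one-point compactification is continuous, then elements with an inverse
vanish. -/
theorem eq_zero_of_continuous_add_onePointCompact {n : ℕ} (S : AddSubmonoid (Fin n → ℤ))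
    (hc : @Continuous _ _
      (@instTopologicalSpaceProd _ _ (onePointCompactTopology S) (onePointCompactTopology S))
      (onePointCompactTopology S)
      (fun p : WithTop S × WithTop S => p.1 + p.2))
    {a b : S} (hab : a + b = 0) : a = 0 := by
  let _ := onePointCompactTopology S
  by_contra ha
  have hb : b ≠ 0 := by
    rintro rfl
    exact ha (by simpa using hab)
  have hinj (c : S) (hc0 : c ≠ 0) : Function.Injective fun m : ℕ => ((m • c : S) : WithTop S) := by
    intro i j hij
    have hij' : (i : ℤ) • (c : Fin n → ℤ) = (j : ℤ) • (c : Fin n → ℤ) := by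
      simpa using congrArg Subtype.val (WithTop.coe_injective hij)
    exact Nat.cast_injective <| smul_left_injective ℤ (fun h => hc0 (Subtype.ext h)) hij'
  have hU : IsOpen ({((0 : S) : WithTop S)}ᶜ) := by
    intro _
    rw [compl_compl]
    exact Set.finite_singleton _
  obtain ⟨V, W, hV, hW, hVt, hWt, hsub⟩ :=
    isOpen_prod_iff.mp (hU.preimage hc) ⊤ ⊤ (by simp)
  obtain ⟨m, hm⟩ := (((hV hVt).preimage (hinj a ha).injOn).union
    ((hW hWt).preimage (hinj b hb).injOn)).exists_notMem
  simp only [Set.mem_union, Set.mem_preimage, Set.mem_compl_iff, not_or, not_not] at hm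
  refine hsub (Set.mk_mem_prod hm.1 hm.2) ?_
  change ((m • a + m • b : S) : WithTop S) = (0 : S)
  rw [← nsmul_add, hab, nsmul_zero]

/-- For an affine semigroup `S` (discrete topology), addition on the one-point
compactification `S_∞` is continuous (for the product topology) iff `S` is pointed. -/
theorem stmt_3 {n : ℕ} (S : AddSubmonoid (Fin n → ℤ)) (hfg : S.FG) :
    @Continuous _ _
      (@instTopologicalSpaceProd _ _ (onePointCompactTopology S) (onePointCompactTopology S))
      (onePointCompactTopology S)
      (fun p : WithTop S × WithTop S => p.1 + p.2) ↔
    (∀ a b : S, a + b = 0 → a = 0 ∧ b = 0) := by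
  have : AddMonoid.FG S := (AddMonoid.fg_iff_addSubmonoid_fg S).mpr hfg
  refine ⟨fun hc a b hab => ?_, fun h => ?_⟩
  · exact ⟨eq_zero_of_continuous_add_onePointCompact S hc hab,
      eq_zero_of_continuous_add_onePointCompact S hc ((add_comm b a).trans hab)⟩
  · exact continuous_add_onePointCompact S (finite_setOf_add_eq_of_pointed h)
end

section
/- Let S be a pointed affine semigroup and let D be a ℂ-derivation on ℂ[S_∞]. Then for every c ∈ ℂ and every f ∈ ℂ[S_∞] one has (1 + c·χ^∞)·D(f) = D(f). -/
namespace Derivation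

theorem apply_eq_zero_of_isIdempotentElem {R A M : Type*} [CommRing R] [CommRing A] [Algebra R A]
    [AddCommGroup M] [Module A M] [Module R M] (D : Derivation R A M) {e : A}
    (he : IsIdempotentElem e) : D e = 0 := by
  have h : D e = e • D e + e • D e := by
    conv_lhs => rw [← he.eq, D.leibniz]
  have h' : e • D e = 0 := by
    have := congrArg (e • ·) h
    simpa [smul_smul, he.eq] using this
  rw [h, h', add_zero]

end Derivation

namespace AddMonoidAlgebra

theorem isIdempotentElem_single_top {R M : Type*} [Semiring R] [AddMonoid M] :
    IsIdempotentElem (single (⊤ : WithTop M) (1 : R)) := by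
  simp [IsIdempotentElem, single_mul_single]

theorem exists_single_top_mul_eq_smul {R M : Type*} [CommSemiring R] [AddMonoid M]
    (f : AddMonoidAlgebra R (WithTop M)) :
    ∃ r : R, single (⊤ : WithTop M) (1 : R) * f = r • single (⊤ : WithTop M) (1 : R) := by
  induction f using AddMonoidAlgebra.induction_linear with
  | zero => exact ⟨0, by simp⟩
  | add f g hf hg =>
    obtain ⟨r, hr⟩ := hf
    obtain ⟨s, hs⟩ := hg
    exact ⟨r + s, by rw [mul_add, hr, hs, add_smul]⟩
  | single a b => exact ⟨b, by simp [single_mul_single]⟩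

theorem single_top_mul_derivation {R M : Type*} [CommRing R] [AddCommMonoid M]
    (D : Derivation R (AddMonoidAlgebra R (WithTop M)) (AddMonoidAlgebra R (WithTop M)))
    (f : AddMonoidAlgebra R (WithTop M)) :
    single (⊤ : WithTop M) (1 : R) * D f = 0 := by
  obtain ⟨r, hr⟩ := exists_single_top_mul_eq_smul f
  have hD := D.apply_eq_zero_of_isIdempotentElem (isIdempotentElem_single_top (R := R) (M := M))
  have h := congrArg D hr
  rwa [D.leibniz, D.map_smul, hD, smul_zero, smul_zero, add_zero, smul_eq_mul] at h

end AddMonoidAlgebra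

/-- For a pointed affine semigroup `S` and a ℂ-derivation `D` on `ℂ[S_∞]`,
for every `c ∈ ℂ` and `f ∈ ℂ[S_∞]` one has `(1 + c·χ^∞) · D(f) = D(f)`. -/
theorem stmt_5 {n : ℕ} (S : AddSubmonoid (Fin n → ℤ)) (hfg : S.FG)
    (hpointed : ∀ a b : S, a + b = 0 → a = 0 ∧ b = 0)
    (D : Derivation ℂ (AddMonoidAlgebra ℂ (WithTop S)) (AddMonoidAlgebra ℂ (WithTop S)))
    (c : ℂ) (f : AddMonoidAlgebra ℂ (WithTop S)) :
    (1 + AddMonoidAlgebra.single (⊤ : WithTop S) c) * D f = D f := by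
  have hc : AddMonoidAlgebra.single (⊤ : WithTop S) c =
      c • AddMonoidAlgebra.single (⊤ : WithTop S) (1 : ℂ) := by simp
  rw [add_mul, one_mul, hc, smul_mul_assoc, AddMonoidAlgebra.single_top_mul_derivation, smul_zero,
    add_zero]
end

section
/- Let S be a pointed affine semigroup and let D be a ℂ-derivation on ℂ[S_∞] that is homogeneous, i.e., for every x ∈ S_∞ there exist y ∈ S_∞ and c ∈ ℂ with D(χ^x) = c·χ^y. Then D = 0. -/
/-- A derivation of a commutative algebra into itself kills idempotents. -/
theorem Derivation.apply_eq_zero_of_isIdempotentElem_s6 {R A : Type*} [CommSemiring R] [CommRing A]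
    [Algebra R A] (D : Derivation R A A) {e : A} (he : IsIdempotentElem e) : D e = 0 := by
  have h : e * D e + e * D e = D e := by
    simpa only [he.eq, smul_eq_mul] using (D.leibniz e e).symm
  linear_combination (2 * e - 1) * h - 4 * D e * he.eq

/-- For a pointed affine semigroup `S`, every homogeneous ℂ-derivation on
`ℂ[S_∞]` (each `D(χ^x)` a scalar multiple of a single monomial) is zero. -/
theorem stmt_6 {n : ℕ} (S : AddSubmonoid (Fin n → ℤ)) (hfg : S.FG)
    (hpointed : ∀ a b : S, a + b = 0 → a = 0 ∧ b = 0)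
    (D : Derivation ℂ (AddMonoidAlgebra ℂ (WithTop S)) (AddMonoidAlgebra ℂ (WithTop S)))
    (hhom : ∀ x : WithTop S, ∃ (y : WithTop S) (c : ℂ),
      D (AddMonoidAlgebra.single x 1) = c • AddMonoidAlgebra.single y 1) :
    D = 0 := by
  have htop : D (AddMonoidAlgebra.single ⊤ 1) = 0 :=
    D.apply_eq_zero_of_isIdempotentElem_s6 <| by
      simp [IsIdempotentElem, AddMonoidAlgebra.single_mul_single]
  have hmon (x : WithTop S) : D (AddMonoidAlgebra.single x 1) = 0 := by
    obtain ⟨y, c, hxy⟩ := hhom x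
    have h := D.leibniz (AddMonoidAlgebra.single ⊤ 1) (AddMonoidAlgebra.single x 1)
    simp only [AddMonoidAlgebra.single_mul_single, WithTop.top_add, mul_one, htop, mul_zero, add_zero,
      hxy, smul_eq_mul, mul_smul_comm] at h
    have hc : c = 0 := (smul_eq_zero.mp h.symm).resolve_right (by simp)
    rw [hxy, hc, zero_smul]
  refine Derivation.ext fun f => ?_
  induction f using AddMonoidAlgebra.induction_on with
  | of x => exact hmon x
  | add f g hf hg => simp_all
  | smul r f hf => simp_all
end

section
/- Let S be a pointed affine semigroup and let D, D' be ℂ-derivations on ℂ[S_∞]. Then D = D' if and only if D and D' agree on the ideal I_∞ = {f ∈ ℂ[S_∞] : f·χ^∞ = 0}, i.e., D(f) = D'(f) for every f with f·χ^∞ = 0. -/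
/-- A derivation vanishes on every idempotent. -/
theorem Derivation.map_of_isIdempotentElem {R A M : Type*} [CommSemiring R] [CommRing A]
    [Algebra R A] [AddCommGroup M] [Module R M] [Module A M] (D : Derivation R A M) {e : A}
    (he : IsIdempotentElem e) : D e = 0 := by
  have h : D e = e • D e + e • D e := by
    conv_lhs => rw [← he.eq, D.leibniz]
  have h0 : e • D e = 0 := by
    have h1 := congrArg (e • ·) h
    simp only [smul_add, smul_smul, he.eq] at h1
    exact left_eq_add.mp h1
  rw [h, h0, add_zero]

/-- For a pointed affine semigroup `S` and ℂ-derivations `D, D'` on `ℂ[S_∞]`,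
`D = D'` iff they agree on the ideal `I_∞ = {f : f·χ^∞ = 0}`. -/
theorem stmt_8 {n : ℕ} (S : AddSubmonoid (Fin n → ℤ)) (hfg : S.FG)
    (hpointed : ∀ a b : S, a + b = 0 → a = 0 ∧ b = 0)
    (D D' : Derivation ℂ (AddMonoidAlgebra ℂ (WithTop S)) (AddMonoidAlgebra ℂ (WithTop S))) :
    D = D' ↔
      ∀ f : AddMonoidAlgebra ℂ (WithTop S),
        f * AddMonoidAlgebra.single (⊤ : WithTop S) 1 = 0 → D f = D' f := by
  refine ⟨fun h f _ => by rw [h], fun h => ?_⟩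
  have he : IsIdempotentElem (AddMonoidAlgebra.single (⊤ : WithTop S) (1 : ℂ)) := by
    simp [IsIdempotentElem, AddMonoidAlgebra.single_mul_single]
  ext f : 1
  induction f using AddMonoidAlgebra.induction_linear with
  | zero => simp
  | add f g hf hg => rw [map_add, map_add, hf, hg]
  | single x c =>
    have key := h (AddMonoidAlgebra.single x c - c • AddMonoidAlgebra.single ⊤ 1) (by
      simp [sub_mul, AddMonoidAlgebra.single_mul_single])
    simpa only [map_sub, Derivation.map_smul, D.map_of_isIdempotentElem he,
      D'.map_of_isIdempotentElem he, smul_zero, sub_zero] using key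
end

section
/- Let S be a pointed affine semigroup and let π : ℂ[S_∞] → ℂ[S] be the ℂ-linear map determined by π(χ^a) = χ^a for a ∈ S and π(χ^∞) = 0 (deleting the coefficient of χ^∞). Then for every ℂ-derivation D on ℂ[S_∞] there exists a ℂ-derivation D' on ℂ[S] such that D'(χ^a) = π(D(χ^a)) for all a ∈ S. -/
/-- The inclusion `k[M] → k[M_∞]` sending `χ^a` to `χ^a`. -/
noncomputable def AddMonoidAlgebra.withTopInclusion (k M : Type*) [CommSemiring k]
    [AddCommMonoid M] : AddMonoidAlgebra k M →ₐ[k] AddMonoidAlgebra k (WithTop M) :=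
  AddMonoidAlgebra.mapDomainAlgHom k k (WithTop.addHom : M →+ WithTop M)

theorem AddMonoidAlgebra.withTopInclusion_single {k M : Type*} [CommSemiring k]
    [AddCommMonoid M] (a : M) (r : k) :
    withTopInclusion k M (single a r) = single (a : WithTop M) r := by
  simp [withTopInclusion]

/-- A linear map `k[M_∞] → k[M]` with `χ^a ↦ χ^a` and `χ^∞ ↦ 0` is `k[M]`-linear. -/
theorem AddMonoidAlgebra.map_withTopInclusion_mul {k M : Type*} [CommSemiring k]
    [AddCommMonoid M] (π : AddMonoidAlgebra k (WithTop M) →ₗ[k] AddMonoidAlgebra k M)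
    (hπ : ∀ a : M, π (single (a : WithTop M) 1) = single a 1)
    (hπtop : π (single (⊤ : WithTop M) 1) = 0)
    (f : AddMonoidAlgebra k M) (x : AddMonoidAlgebra k (WithTop M)) :
    π (withTopInclusion k M f * x) = f * π x := by
  have single_eq (c : WithTop M) (r : k) : π (single c r) = r • π (single c 1) := by
    rw [← map_smul, smul_single, smul_eq_mul, mul_one]
  induction f using AddMonoidAlgebra.induction_linear with
  | zero => simp
  | add f g hf hg => simp only [map_add, add_mul, hf, hg]
  | single a r =>
    induction x using AddMonoidAlgebra.induction_linear with
    | zero => simp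
    | add x y hx hy => simp only [map_add, mul_add, hx, hy]
    | single c t =>
      rw [withTopInclusion_single, single_mul_single, single_eq, single_eq c]
      induction c using WithTop.recTopCoe with
      | top => simp [hπtop]
      | coe b => rw [← WithTop.coe_add, hπ, hπ]; simp [single_mul_single]


/-- Let `π : ℂ[S_∞] → ℂ[S]` be the ℂ-linear map with `π(χ^a) = χ^a` for
`a ∈ S` and `π(χ^∞) = 0`. For every ℂ-derivation `D` on `ℂ[S_∞]` there is a ℂ-derivation
`D'` on `ℂ[S]` with `D'(χ^a) = π(D(χ^a))` for all `a ∈ S`. -/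
theorem stmt_9 {n : ℕ} (S : AddSubmonoid (Fin n → ℤ)) (hfg : S.FG)
    (hpointed : ∀ a b : S, a + b = 0 → a = 0 ∧ b = 0)
    (π : AddMonoidAlgebra ℂ (WithTop S) →ₗ[ℂ] AddMonoidAlgebra ℂ S)
    (hπ : ∀ a : S, π (AddMonoidAlgebra.single (a : WithTop S) 1) = AddMonoidAlgebra.single a 1)
    (hπtop : π (AddMonoidAlgebra.single (⊤ : WithTop S) 1) = 0)
    (D : Derivation ℂ (AddMonoidAlgebra ℂ (WithTop S)) (AddMonoidAlgebra ℂ (WithTop S))) :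
    ∃ D' : Derivation ℂ (AddMonoidAlgebra ℂ S) (AddMonoidAlgebra ℂ S),
      ∀ a : S, D' (AddMonoidAlgebra.single a 1) =
        π (D (AddMonoidAlgebra.single (a : WithTop S) 1)) := by
  refine ⟨Derivation.mk'
    (π ∘ₗ D.toLinearMap ∘ₗ (AddMonoidAlgebra.withTopInclusion ℂ S).toLinearMap) fun f g => ?_,
    fun a => ?_⟩
  · simp [AddMonoidAlgebra.map_withTopInclusion_mul π hπ hπtop]
  · change π (D (AddMonoidAlgebra.withTopInclusion ℂ S _)) = _
    rw [AddMonoidAlgebra.withTopInclusion_single]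
end

section
/- Let S be a pointed affine semigroup, let ι : ℂ[S] → ℂ[S_∞] be the algebra homomorphism induced by the inclusion S ↪ S_∞, and let I_∞ = {f ∈ ℂ[S_∞] : f·χ^∞ = 0}. Then for every ℂ-derivation D' on ℂ[S] and every f ∈ I_∞ there exists a ℂ-derivation D on ℂ[S_∞] with D(χ^∞) = 0 and D(χ^a) = f·ι(D'(χ^a)) for all a ∈ S. -/
/-- A function on an additive monoid satisfying the Leibniz rule on monomials extends to a
derivation on the monoid algebra. -/
theorem exists_derivation_of_single {R M : Type*} [CommRing R] [AddCommMonoid M]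
    (g : M → AddMonoidAlgebra R M)
    (hg : ∀ x y, g (x + y) =
      AddMonoidAlgebra.single x 1 * g y + AddMonoidAlgebra.single y 1 * g x) :
    ∃ D : Derivation R (AddMonoidAlgebra R M) (AddMonoidAlgebra R M),
      ∀ x, D (AddMonoidAlgebra.single x 1) = g x := by
  let L : AddMonoidAlgebra R M →ₗ[R] AddMonoidAlgebra R M :=
    Finsupp.linearCombination R g ∘ₗ (AddMonoidAlgebra.coeffLinearEquiv R).toLinearMap
  have hL (x : M) (r : R) : L (AddMonoidAlgebra.single x r) = r • g x := by
    simp [L]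
  refine ⟨Derivation.mk' L fun p q => ?_, fun x => by simp [hL]⟩
  induction p using AddMonoidAlgebra.induction_linear with
  | zero => simp
  | add p p' hp hp' => simp only [add_mul, map_add, hp, hp', smul_eq_mul]; ring
  | single x r =>
    induction q using AddMonoidAlgebra.induction_linear with
    | zero => simp
    | add q q' hq hq' => simp only [mul_add, map_add, hq, hq', smul_eq_mul]; ring
    | single y s =>
      have h (z : M) (t : R) : (AddMonoidAlgebra.single z t : AddMonoidAlgebra R M) =
          t • AddMonoidAlgebra.single z 1 := by simp
      rw [AddMonoidAlgebra.single_mul_single, hL, hL, hL, hg, h x r, h y s]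
      simp only [smul_eq_mul, smul_mul_assoc, mul_smul_comm, smul_add, smul_smul, mul_comm s r]


/-- Let `ι : ℂ[S] → ℂ[S_∞]` be the algebra homomorphism induced by the
inclusion `S ↪ S_∞`. For every ℂ-derivation `D'` on `ℂ[S]` and every `f ∈ I_∞`
(`f·χ^∞ = 0`), there is a ℂ-derivation `D` on `ℂ[S_∞]` with `D(χ^∞) = 0` and
`D(χ^a) = f·ι(D'(χ^a))` for all `a ∈ S`. -/
theorem stmt_10 {n : ℕ} (S : AddSubmonoid (Fin n → ℤ)) (hfg : S.FG)
    (hpointed : ∀ a b : S, a + b = 0 → a = 0 ∧ b = 0)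
    (ι : AddMonoidAlgebra ℂ S →ₐ[ℂ] AddMonoidAlgebra ℂ (WithTop S))
    (hι : ∀ a : S, ι (AddMonoidAlgebra.single a 1) = AddMonoidAlgebra.single (a : WithTop S) 1)
    (D' : Derivation ℂ (AddMonoidAlgebra ℂ S) (AddMonoidAlgebra ℂ S))
    (f : AddMonoidAlgebra ℂ (WithTop S))
    (hf : f * AddMonoidAlgebra.single (⊤ : WithTop S) 1 = 0) :
    ∃ D : Derivation ℂ (AddMonoidAlgebra ℂ (WithTop S)) (AddMonoidAlgebra ℂ (WithTop S)),
      D (AddMonoidAlgebra.single (⊤ : WithTop S) 1) = 0 ∧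
      ∀ a : S, D (AddMonoidAlgebra.single (a : WithTop S) 1) =
        f * ι (D' (AddMonoidAlgebra.single a 1)) := by
  let g : WithTop S → AddMonoidAlgebra ℂ (WithTop S) :=
    WithTop.recTopCoe 0 fun a => f * ι (D' (AddMonoidAlgebra.single a 1))
  obtain ⟨D, hD⟩ := exists_derivation_of_single g fun x y => by
    induction x using WithTop.recTopCoe with
    | top =>
      induction y using WithTop.recTopCoe with
      | top => simp [g]
      | coe b =>
        change 0 = AddMonoidAlgebra.single ⊤ 1 * (f * _) + AddMonoidAlgebra.single _ 1 * 0
        linear_combination (-ι (D' (AddMonoidAlgebra.single b 1))) * hf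
    | coe a =>
      induction y using WithTop.recTopCoe with
      | top =>
        change 0 = AddMonoidAlgebra.single _ 1 * 0 + AddMonoidAlgebra.single ⊤ 1 * (f * _)
        linear_combination (-ι (D' (AddMonoidAlgebra.single a 1))) * hf
      | coe b =>
        change f * ι (D' (AddMonoidAlgebra.single (a + b) 1)) =
          AddMonoidAlgebra.single (a : WithTop S) 1 * (f * ι (D' (AddMonoidAlgebra.single b 1))) +
          AddMonoidAlgebra.single (b : WithTop S) 1 * (f * ι (D' (AddMonoidAlgebra.single a 1)))
        have h : (AddMonoidAlgebra.single (a + b) 1 : AddMonoidAlgebra ℂ S) =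
            AddMonoidAlgebra.single a 1 * AddMonoidAlgebra.single b 1 := by
          rw [AddMonoidAlgebra.single_mul_single, one_mul]
        rw [h, D'.leibniz, smul_eq_mul, smul_eq_mul, map_add, map_mul, map_mul, hι, hι]
        ring
  exact ⟨D, hD ⊤, fun a => hD a⟩
end

section
/- Let S be a pointed affine semigroup, let D' be a ℂ-derivation on ℂ[S], and let D be the corresponding ℂ-derivation on ℂ[S_∞] determined by D(χ^∞) = 0 and D(χ^a) = (1 − χ^∞)·ι(D'(χ^a)) for a ∈ S. Then D is locally nilpotent if and only if D' is locally nilpotent. -/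
/-- The algebra homomorphism `ℂ[S_∞] → ℂ[S]` killing `χ^∞` and fixing `χ^a` for `a ∈ S`. -/
noncomputable def killTop (M : Type*) [AddCommMonoid M] :
    AddMonoidAlgebra ℂ (WithTop M) →ₐ[ℂ] AddMonoidAlgebra ℂ M :=
  AddMonoidAlgebra.lift ℂ (AddMonoidAlgebra ℂ M) (WithTop M)
    { toFun := fun x => WithTop.recTopCoe (C := fun _ => AddMonoidAlgebra ℂ M) 0
        (fun a => AddMonoidAlgebra.single a 1) x.toAdd
      map_one' := rfl
      map_mul' := fun x y => by
        rw [toAdd_mul]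
        induction x.toAdd using WithTop.recTopCoe with
        | top => simp
        | coe a =>
          induction y.toAdd using WithTop.recTopCoe with
          | top => simp
          | coe b => simp [← WithTop.coe_add, AddMonoidAlgebra.single_mul_single] }

theorem killTop_single_top (M : Type*) [AddCommMonoid M] :
    killTop M (AddMonoidAlgebra.single ⊤ 1) = 0 := by
  rw [killTop, AddMonoidAlgebra.lift_single, one_smul]
  rfl

theorem killTop_single_coe {M : Type*} [AddCommMonoid M] (a : M) :
    killTop M (AddMonoidAlgebra.single (a : WithTop M) 1) = AddMonoidAlgebra.single a 1 := by
  rw [killTop, AddMonoidAlgebra.lift_single, one_smul]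
  rfl


/-- If `D` on `ℂ[S_∞]` corresponds to `D'` on `ℂ[S]` via `D(χ^∞) = 0` and
`D(χ^a) = (1 − χ^∞)·ι(D'(χ^a))`, then `D` is locally nilpotent iff `D'` is. -/
theorem stmt_12 {n : ℕ} (S : AddSubmonoid (Fin n → ℤ)) (hfg : S.FG)
    (hpointed : ∀ a b : S, a + b = 0 → a = 0 ∧ b = 0)
    (ι : AddMonoidAlgebra ℂ S →ₐ[ℂ] AddMonoidAlgebra ℂ (WithTop S))
    (hι : ∀ a : S, ι (AddMonoidAlgebra.single a 1) = AddMonoidAlgebra.single (a : WithTop S) 1)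
    (D' : Derivation ℂ (AddMonoidAlgebra ℂ S) (AddMonoidAlgebra ℂ S))
    (D : Derivation ℂ (AddMonoidAlgebra ℂ (WithTop S)) (AddMonoidAlgebra ℂ (WithTop S)))
    (hDtop : D (AddMonoidAlgebra.single (⊤ : WithTop S) 1) = 0)
    (hD : ∀ a : S, D (AddMonoidAlgebra.single (a : WithTop S) 1) =
      (1 - AddMonoidAlgebra.single (⊤ : WithTop S) 1) * ι (D' (AddMonoidAlgebra.single a 1))) :
    (∀ f : AddMonoidAlgebra ℂ (WithTop S), ∃ m : ℕ, (⇑D)^[m] f = 0) ↔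
    (∀ g : AddMonoidAlgebra ℂ S, ∃ m : ℕ, (⇑D')^[m] g = 0) := by
  set e : AddMonoidAlgebra ℂ (WithTop S) := 1 - AddMonoidAlgebra.single ⊤ 1 with he
  have hee : e * e = e := by
    have : (AddMonoidAlgebra.single ⊤ 1 * AddMonoidAlgebra.single ⊤ 1 :
        AddMonoidAlgebra ℂ (WithTop S)) = AddMonoidAlgebra.single ⊤ 1 := by
      simp [AddMonoidAlgebra.single_mul_single]
    rw [he]
    linear_combination this
  have hDe : D e = 0 := by simp [he, hDtop]
  have hDι : ∀ g, D (ι g) = e * ι (D' g) := by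
    have : D.toLinearMap ∘ₗ ι.toLinearMap =
        LinearMap.mulLeft ℂ e ∘ₗ ι.toLinearMap ∘ₗ D'.toLinearMap := by
      ext a : 2
      simp [hι, hD]
    exact fun g => LinearMap.congr_fun this g
  have hiter : ∀ m g, (⇑D)^[m + 1] (ι g) = e * ι ((⇑D')^[m + 1] g) := by
    intro m g
    induction m with
    | zero => simp [hDι]
    | succ m ih =>
      rw [Function.iterate_succ_apply', ih, Function.iterate_succ_apply' _ (m + 1),
        Derivation.leibniz, hDe, smul_zero, add_zero, hDι, smul_eq_mul, ← mul_assoc, hee]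
  have hkill : ∀ g, killTop S (e * ι g) = g := by
    have hι' : ∀ g, killTop S (ι g) = g := by
      have : (killTop S).toLinearMap ∘ₗ ι.toLinearMap = LinearMap.id := by
        ext a : 2
        simp [hι, killTop_single_coe]
      exact fun g => LinearMap.congr_fun this g
    intro g
    rw [map_mul, hι', he, map_sub, map_one, killTop_single_top, sub_zero, one_mul]
  have hzero : ∀ m, (⇑D)^[m] 0 = 0 := fun m => iterate_map_zero D m
  constructor
  · intro h g
    obtain ⟨m, hm⟩ := h (ι g)
    refine ⟨m + 1, ?_⟩
    rw [← hkill ((⇑D')^[m + 1] g), ← hiter, Function.iterate_succ_apply', hm, map_zero, map_zero]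
  · intro h f
    induction f using AddMonoidAlgebra.induction_linear with
    | zero => exact ⟨0, rfl⟩
    | add f g hf hg =>
      obtain ⟨k, hk⟩ := hf
      obtain ⟨l, hl⟩ := hg
      refine ⟨k + l, ?_⟩
      rw [iterate_map_add, Function.iterate_add_apply D k l g, hl, hzero, add_zero, add_comm k l,
        Function.iterate_add_apply, hk, hzero]
    | single x c =>
      have hx : AddMonoidAlgebra.single x c = c • AddMonoidAlgebra.single x (1 : ℂ) := by simp
      induction x using WithTop.recTopCoe with
      | top => exact ⟨1, by rw [hx, Function.iterate_one, Derivation.map_smul, hDtop, smul_zero]⟩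
      | coe a =>
        obtain ⟨m, hm⟩ := h (c • AddMonoidAlgebra.single a 1)
        refine ⟨m + 1, ?_⟩
        rw [hx, ← hι, ← map_smul, hiter, Function.iterate_succ_apply', hm, map_zero, map_zero,
          mul_zero]
end

section
/- Let S be an affine semigroup generating ℤ^n as a group, let S^sat = {m ∈ ℤ^n : ∃ k ≥ 1, k·m ∈ S} be its saturation, and let ι' : ℂ[S] → ℂ[S^sat] be the algebra homomorphism induced by the inclusion S ⊆ S^sat. If D is a nonzero locally nilpotent ℂ-derivation on ℂ[S] that is homogeneous of degree e ∈ ℤ^n, then there exists a locally nilpotent ℂ-derivation D'' on ℂ[S^sat], homogeneous of degree e, such that D'' ∘ ι' = ι' ∘ D. -/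
/-- The saturation `S^sat = {m ∈ ℤ^n : ∃ k ≥ 1, k·m ∈ S}` of a submonoid `S ⊆ ℤ^n`. -/
def saturation {n : ℕ} (S : AddSubmonoid (Fin n → ℤ)) : AddSubmonoid (Fin n → ℤ) where
  carrier := {m | ∃ k : ℕ, 1 ≤ k ∧ k • m ∈ S}
  zero_mem' := ⟨1, le_refl 1, by simpa using S.zero_mem⟩
  add_mem' := by
    rintro a b ⟨k, hk, hka⟩ ⟨l, hl, hlb⟩
    refine ⟨k * l, Nat.one_le_iff_ne_zero.mpr (Nat.mul_ne_zero (by omega) (by omega)), ?_⟩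
    rw [smul_add]
    have h1 : (k * l) • a = l • (k • a) := by rw [mul_comm, mul_smul]
    have h2 : (k * l) • b = k • (l • b) := by rw [mul_smul]
    rw [h1, h2]
    exact S.add_mem (AddSubmonoid.nsmul_mem S hka l) (AddSubmonoid.nsmul_mem S hlb k)

theorem le_saturation {n : ℕ} (S : AddSubmonoid (Fin n → ℤ)) : S ≤ saturation S :=
  fun x hx => ⟨1, le_refl 1, by simpa using hx⟩

/-- A derivation on `ℂ[S]` is homogeneous of degree `e ∈ ℤ^n` if for every `a ∈ S` there
is `c ∈ ℂ` with `D(χ^a) = c·χ^{a+e}`, where `c = 0` (i.e. `D(χ^a) = 0`) when `a+e ∉ S`. -/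
def IsHomogeneousOfDegree {n : ℕ} (S : AddSubmonoid (Fin n → ℤ))
    (D : Derivation ℂ (AddMonoidAlgebra ℂ S) (AddMonoidAlgebra ℂ S)) (e : Fin n → ℤ) : Prop :=
  ∀ a : S,
    (∀ h : (a : Fin n → ℤ) + e ∈ S, ∃ c : ℂ,
      D (AddMonoidAlgebra.single a 1) =
        AddMonoidAlgebra.single (⟨(a : Fin n → ℤ) + e, h⟩ : S) c) ∧
    ((a : Fin n → ℤ) + e ∉ S → D (AddMonoidAlgebra.single a 1) = 0)

open AddMonoidAlgebra

section GroupOfDifferences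

variable {G A : Type*} [AddCommGroup G] [AddCommGroup A] {S : AddSubmonoid G}

/-- If a submonoid generates a group, then every element is a difference of elements of it. -/
theorem exists_eq_sub_of_closure_eq_top (hgen : AddSubgroup.closure (S : Set G) = ⊤) (x : G) :
    ∃ a b : S, x = a - b := by
  have hx : x ∈ AddSubgroup.closure (S : Set G) := hgen ▸ AddSubgroup.mem_top x
  induction hx using AddSubgroup.closure_induction with
  | mem x hx => exact ⟨⟨x, hx⟩, 0, by simp⟩
  | zero => exact ⟨0, 0, by simp⟩
  | add x y _ _ hx hy =>
    obtain ⟨a, b, rfl⟩ := hx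
    obtain ⟨c, d, rfl⟩ := hy
    exact ⟨a + c, b + d, by push_cast; abel⟩
  | neg x _ hx =>
    obtain ⟨a, b, rfl⟩ := hx
    exact ⟨b, a, by abel⟩

/-- An additive map on a submonoid extends to the group generated by the submonoid. -/
theorem exists_addMonoidHom_extension (hgen : AddSubgroup.closure (S : Set G) = ⊤)
    (f : S →+ A) : ∃ g : G →+ A, ∀ a : S, g a = f a := by
  choose p q hpq using exists_eq_sub_of_closure_eq_top hgen
  have key (a b c d : S) (h : (a - b : G) = c - d) : f a - f b = f c - f d := by
    have h' : a + d = c + b := Subtype.ext (sub_eq_sub_iff_add_eq_add.mp h)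
    rw [sub_eq_sub_iff_add_eq_add, ← map_add, ← map_add, h']
  refine ⟨AddMonoidHom.mk' (fun x ↦ f (p x) - f (q x)) fun x y ↦ ?_, fun a ↦ ?_⟩
  · rw [key (p (x + y)) (q (x + y)) (p x + p y) (q x + q y), map_add, map_add]
    · abel
    · rw [← hpq]
      push_cast
      rw [add_sub_add_comm, ← hpq, ← hpq]
  · simpa using key (p a) (q a) a 0 (by simp [← hpq])

end GroupOfDifferences

section ShiftDerivation

variable {G : Type*} [AddCommGroup G] (T : AddSubmonoid G)

open Classical in
/-- The monomial `χ^x`, with the convention that it vanishes for `x ∉ T`. -/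
noncomputable def truncatedMonomial (x : G) : AddMonoidAlgebra ℂ T :=
  if h : x ∈ T then single ⟨x, h⟩ 1 else 0

theorem truncatedMonomial_of_mem {x : G} (h : x ∈ T) :
    truncatedMonomial T x = single ⟨x, h⟩ 1 :=
  dif_pos h

theorem truncatedMonomial_of_notMem {x : G} (h : x ∉ T) : truncatedMonomial T x = 0 :=
  dif_neg h

theorem single_mul_truncatedMonomial (a : T) {x : G} (h : x ∈ T) :
    single a 1 * truncatedMonomial T x = truncatedMonomial T (a + x) := by
  rw [truncatedMonomial_of_mem T h, truncatedMonomial_of_mem T (T.add_mem a.2 h),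
    single_mul_single, one_mul]
  rfl

/-- The linear map `χ^a ↦ g(a) χ^{a+e}` on `ℂ[T]`. -/
noncomputable def shiftLinearMap (g : G →+ ℂ) (e : G) :
    AddMonoidAlgebra ℂ T →ₗ[ℂ] AddMonoidAlgebra ℂ T :=
  (Finsupp.linearCombination ℂ fun a : T ↦ g a • truncatedMonomial T (a + e)) ∘ₗ
    (coeffLinearEquiv ℂ).toLinearMap

theorem shiftLinearMap_single (g : G →+ ℂ) (e : G) (a : T) (c : ℂ) :
    shiftLinearMap T g e (single a c) = c • g a • truncatedMonomial T (a + e) := by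
  simp [shiftLinearMap]

variable {T}

/-- The derivation `χ^a ↦ g(a) χ^{a+e}` on `ℂ[T]`, provided that `a + e ∈ T` for all `a ∈ T`
with `g(a) ≠ 0`. -/
noncomputable def shiftDerivation (g : G →+ ℂ) (e : G) (h : ∀ a ∈ T, g a ≠ 0 → a + e ∈ T) :
    Derivation ℂ (AddMonoidAlgebra ℂ T) (AddMonoidAlgebra ℂ T) :=
  Derivation.mk' (shiftLinearMap T g e) fun x y ↦ by
    have key (a b : T) : single a (1 : ℂ) * g b • truncatedMonomial T (b + e) =
        g b • truncatedMonomial T (a + b + e) := by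
      by_cases hb : g b = 0
      · simp [hb]
      · rw [mul_smul_comm, single_mul_truncatedMonomial T a (h b b.2 hb), add_assoc]
    induction x using induction_linear with
    | zero => simp
    | add x₁ x₂ h₁ h₂ => rw [add_mul, map_add, map_add, h₁, h₂, smul_add, add_smul]; abel
    | single a c =>
      induction y using induction_linear with
      | zero => simp
      | add y₁ y₂ h₁ h₂ => rw [mul_add, map_add, map_add, h₁, h₂, smul_add, add_smul]; abel
      | single b d =>
        have ha : single a c = c • single a (1 : ℂ) := by simp
        have hb : single b d = d • single b (1 : ℂ) := by simp
        rw [single_mul_single, shiftLinearMap_single, shiftLinearMap_single,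
          shiftLinearMap_single, smul_eq_mul, smul_eq_mul, ha, hb, smul_mul_smul_comm,
          smul_mul_smul_comm, key a b, key b a, add_comm (b : G) a]
        simp only [AddSubmonoid.coe_add, map_add, add_smul, smul_add]
        rw [mul_comm d c, add_comm]

theorem shiftDerivation_single (g : G →+ ℂ) (e : G) (h : ∀ a ∈ T, g a ≠ 0 → a + e ∈ T)
    (a : T) (c : ℂ) :
    shiftDerivation g e h (single a c) = c • g a • truncatedMonomial T (a + e) :=
  shiftLinearMap_single T g e a c

theorem shiftDerivation_locallyNilpotent (g : G →+ ℂ) (e : G)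
    (h : ∀ a ∈ T, g a ≠ 0 → a + e ∈ T) (hg : ∀ a ∈ T, ∃ i : ℕ, g a + i * g e = 0)
    (f : AddMonoidAlgebra ℂ T) : ∃ m : ℕ, (⇑(shiftDerivation g e h))^[m] f = 0 := by
  set E := shiftDerivation g e h with hE
  have zero_of_le {x : AddMonoidAlgebra ℂ T} {i j : ℕ} (hij : i ≤ j) (hx : E^[i] x = 0) :
      E^[j] x = 0 := by
    rw [← Nat.sub_add_cancel hij, Function.iterate_add_apply, hx, iterate_map_zero]
  induction f using induction_linear with
  | zero => exact ⟨0, rfl⟩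
  | add x y hx hy =>
    obtain ⟨i, hi⟩ := hx
    obtain ⟨j, hj⟩ := hy
    refine ⟨max i j, ?_⟩
    rw [iterate_map_add, zero_of_le (le_max_left i j) hi, zero_of_le (le_max_right i j) hj,
      add_zero]
  | single a c =>
    obtain ⟨i, hi⟩ := hg a a.2
    refine ⟨i + 1, ?_⟩
    induction i generalizing a c with
    | zero =>
      have : g a = 0 := by simpa using hi
      simp [hE, shiftDerivation_single, this]
    | succ i ih =>
      by_cases ha : a + e ∈ T
      · rw [Function.iterate_succ_apply, hE, shiftDerivation_single,
          truncatedMonomial_of_mem T ha, ← hE, smul_single, smul_single]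
        apply ih
        rw [map_add]
        push_cast at hi
        linear_combination hi
      · rw [Function.iterate_succ_apply, hE, shiftDerivation_single,
          truncatedMonomial_of_notMem T ha, smul_zero, smul_zero, iterate_map_zero]

end ShiftDerivation

section HomogeneousDerivation

variable {n : ℕ} {S : AddSubmonoid (Fin n → ℤ)} {e : Fin n → ℤ}

theorem shiftDerivation_isHomogeneousOfDegree (g : (Fin n → ℤ) →+ ℂ)
    (h : ∀ a ∈ S, g a ≠ 0 → a + e ∈ S) :
    IsHomogeneousOfDegree S (shiftDerivation g e h) e := by
  refine fun a ↦ ⟨fun ha ↦ ⟨g a, ?_⟩, fun ha ↦ ?_⟩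
  · rw [shiftDerivation_single, truncatedMonomial_of_mem S ha]
    simp
  · rw [shiftDerivation_single, truncatedMonomial_of_notMem S ha, smul_zero, smul_zero]

/-- A homogeneous derivation of degree `e` has the form `χ^a ↦ g(a) χ^{a+e}` for an additive
map `g`. -/
theorem IsHomogeneousOfDegree.exists_addMonoidHom
    {D : Derivation ℂ (AddMonoidAlgebra ℂ S) (AddMonoidAlgebra ℂ S)}
    (hD : IsHomogeneousOfDegree S D e)
    (hgen : AddSubgroup.closure (S : Set (Fin n → ℤ)) = ⊤) :
    ∃ g : (Fin n → ℤ) →+ ℂ, (∀ a ∈ S, g a ≠ 0 → a + e ∈ S) ∧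
      ∀ a : S, D (single a 1) = g a • truncatedMonomial S (a + e) := by
  let ε : AddMonoidAlgebra ℂ S →ₐ[ℂ] ℂ := AddMonoidAlgebra.lift ℂ ℂ S 1
  have hε (a : S) (c : ℂ) : ε (single a c) = c := by simp [ε]
  let f : S →+ ℂ := AddMonoidHom.mk' (fun a ↦ ε (D (single a 1))) fun a b ↦ by
    have hab : single (a + b) (1 : ℂ) = single a 1 * single b 1 := by
      rw [single_mul_single, one_mul]
    rw [hab, D.leibniz, smul_eq_mul, smul_eq_mul, map_add, map_mul, map_mul, hε, hε, one_mul,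
      one_mul, add_comm]
  obtain ⟨g, hg⟩ := exists_addMonoidHom_extension hgen f
  have hgD (a : S) : g a = ε (D (single a 1)) := hg a
  refine ⟨g, fun a ha hga ↦ ?_, fun a ↦ ?_⟩
  · by_contra hae
    apply hga
    rw [hgD ⟨a, ha⟩, (hD ⟨a, ha⟩).2 hae, map_zero]
  · by_cases hae : (a : Fin n → ℤ) + e ∈ S
    · obtain ⟨c, hc⟩ := (hD a).1 hae
      rw [hgD, hc, hε, truncatedMonomial_of_mem S hae]
      simp
    · rw [(hD a).2 hae, truncatedMonomial_of_notMem S hae, smul_zero]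

end HomogeneousDerivation

section WeightFunction

variable {G : Type*} [AddCommGroup G] {S : AddSubmonoid G} {g : G →+ ℂ} {e : G}

theorem exists_iterate_eq_single
    {D : Derivation ℂ (AddMonoidAlgebra ℂ S) (AddMonoidAlgebra ℂ S)}
    (h : ∀ a ∈ S, g a ≠ 0 → a + e ∈ S)
    (hD : ∀ a : S, D (single a 1) = g a • truncatedMonomial S (a + e))
    (a : S) (ha : ∀ i : ℕ, g a + i * g e ≠ 0) (j : ℕ) :
    ∃ b : S, ∃ c : ℂ, (b : G) = a + j • e ∧ c ≠ 0 ∧ D^[j] (single a 1) = single b c := by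
  induction j with
  | zero => exact ⟨a, 1, by simp, one_ne_zero, rfl⟩
  | succ j ih =>
    obtain ⟨b, c, hb, hc, hj⟩ := ih
    have hgb : g b ≠ 0 := by
      rw [hb, map_add, map_nsmul, nsmul_eq_mul]
      exact ha j
    have hbe := h b b.2 hgb
    refine ⟨⟨b + e, hbe⟩, c * g b, ?_, mul_ne_zero hc hgb, ?_⟩
    · simp only [hb, add_assoc, succ_nsmul]
    · have hs : single b c = c • single b (1 : ℂ) := by simp
      rw [Function.iterate_succ_apply', hj, hs, D.map_smul, hD, truncatedMonomial_of_mem S hbe]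
      simp

theorem exists_add_mul_eq_zero_of_locallyNilpotent
    {D : Derivation ℂ (AddMonoidAlgebra ℂ S) (AddMonoidAlgebra ℂ S)}
    (h : ∀ a ∈ S, g a ≠ 0 → a + e ∈ S)
    (hD : ∀ a : S, D (single a 1) = g a • truncatedMonomial S (a + e))
    (hlnd : ∀ f, ∃ m : ℕ, D^[m] f = 0) (a : S) : ∃ i : ℕ, g a + i * g e = 0 := by
  by_contra! ha
  obtain ⟨m, hm⟩ := hlnd (single a 1)
  obtain ⟨b, c, -, hc, hb⟩ := exists_iterate_eq_single h hD a ha m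
  exact hc (by simpa [hm, eq_comm] using hb)

theorem add_nsmul_mem_of_weight (h : ∀ a ∈ S, g a ≠ 0 → a + e ∈ S) (he : g e ≠ 0)
    {a : G} (ha : a ∈ S) {i : ℕ} (hi : g a + i * g e = 0) {j : ℕ} (hj : j ≤ i) :
    a + j • e ∈ S := by
  induction j with
  | zero => simpa using ha
  | succ j ih =>
    rw [succ_nsmul, ← add_assoc]
    refine h _ (ih (by omega)) fun h0 ↦ ?_
    rw [map_add, map_nsmul, nsmul_eq_mul] at h0
    have h1 : ((i : ℂ) - j) * g e = 0 := by linear_combination hi - h0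
    rcases mul_eq_zero.mp h1 with h2 | h2
    · have : i = j := by exact_mod_cast sub_eq_zero.mp h2
      omega
    · exact he h2

/-- If the weights `-g/g(e)` are natural numbers on `S`, then they are natural numbers on every
element having a positive multiple in `S`. -/
theorem exists_add_mul_eq_zero_of_nsmul_mem (hgen : AddSubgroup.closure (S : Set G) = ⊤)
    (he : g e ≠ 0) (hS : ∀ a : S, ∃ i : ℕ, g a + i * g e = 0) {x : G} {k : ℕ} (hk : 1 ≤ k)
    (hkx : k • x ∈ S) : ∃ i : ℕ, g x + i * g e = 0 := by
  obtain ⟨a, b, rfl⟩ := exists_eq_sub_of_closure_eq_top hgen x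
  obtain ⟨i, hi⟩ := hS a
  obtain ⟨j, hj⟩ := hS b
  obtain ⟨l, hl⟩ := hS ⟨_, hkx⟩
  have hl' : (k : ℂ) * (g a - g b) + l * g e = 0 := by simpa using hl
  have hmul : ((k : ℂ) * (i - j) - l) * g e = 0 := by
    linear_combination (k : ℂ) * hi - (k : ℂ) * hj - hl'
  have hkl : (k : ℤ) * (i - j) = l := by
    exact_mod_cast sub_eq_zero.mp ((mul_eq_zero.mp hmul).resolve_right he)
  have hij : (0 : ℤ) ≤ i - j :=
    nonneg_of_mul_nonneg_right (hkl ▸ Int.natCast_nonneg l) (by exact_mod_cast hk)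
  refine ⟨i - j, ?_⟩
  rw [map_sub, Nat.cast_sub (by omega)]
  linear_combination hi - hj

end WeightFunction

/-- A nonzero homogeneous locally nilpotent derivation on `ℂ[S]` extends to a
homogeneous locally nilpotent derivation of the same degree on `ℂ[S^sat]`. -/
theorem stmt_13 {n : ℕ} (S : AddSubmonoid (Fin n → ℤ)) (hfg : S.FG)
    (hgen : AddSubgroup.closure (S : Set (Fin n → ℤ)) = ⊤)
    (ι' : AddMonoidAlgebra ℂ S →ₐ[ℂ] AddMonoidAlgebra ℂ (saturation S))
    (hι' : ∀ a : S, ι' (AddMonoidAlgebra.single a 1) =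
      AddMonoidAlgebra.single (AddSubmonoid.inclusion (le_saturation S) a) 1)
    (D : Derivation ℂ (AddMonoidAlgebra ℂ S) (AddMonoidAlgebra ℂ S))
    (hD0 : D ≠ 0)
    (hlnd : ∀ f : AddMonoidAlgebra ℂ S, ∃ m : ℕ, (⇑D)^[m] f = 0)
    (e : Fin n → ℤ) (hhom : IsHomogeneousOfDegree S D e) :
    ∃ D'' : Derivation ℂ (AddMonoidAlgebra ℂ (saturation S))
        (AddMonoidAlgebra ℂ (saturation S)),
      (∀ f : AddMonoidAlgebra ℂ (saturation S), ∃ m : ℕ, (⇑D'')^[m] f = 0) ∧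
      IsHomogeneousOfDegree (saturation S) D'' e ∧
      ∀ f : AddMonoidAlgebra ℂ S, D'' (ι' f) = ι' (D f) := by
  obtain ⟨g, hS, hD⟩ := hhom.exists_addMonoidHom hgen
  have hweight := exists_add_mul_eq_zero_of_locallyNilpotent hS hD hlnd
  have he : g e ≠ 0 := by
    intro he
    refine hD0 (Derivation.ext fun f ↦ ?_)
    induction f using induction_linear with
    | zero => simp
    | add x y hx hy => rw [map_add, map_add, hx, hy]
    | single a c =>
      obtain ⟨i, hi⟩ := hweight a
      have hc : single a c = c • single a (1 : ℂ) := by simp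
      have hga : g a = 0 := by simpa [he] using hi
      rw [hc, D.map_smul, hD, hga]
      simp
  have hweight_sat (x : Fin n → ℤ) (hx : x ∈ saturation S) : ∃ i : ℕ, g x + i * g e = 0 := by
    obtain ⟨k, hk, hkx⟩ := hx
    exact exists_add_mul_eq_zero_of_nsmul_mem hgen he hweight hk hkx
  have hsat : ∀ x ∈ saturation S, g x ≠ 0 → x + e ∈ saturation S := by
    intro x hx hgx
    obtain ⟨i, hi⟩ := hweight_sat x hx
    obtain ⟨k, hk, hkx⟩ := hx
    have hi0 : i ≠ 0 := by
      rintro rfl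
      exact hgx (by simpa using hi)
    refine ⟨k, hk, ?_⟩
    rw [smul_add]
    refine add_nsmul_mem_of_weight hS he hkx (i := k * i) ?_
      (Nat.le_mul_of_pos_right k (Nat.pos_of_ne_zero hi0))
    rw [map_nsmul, nsmul_eq_mul]
    push_cast
    linear_combination (k : ℂ) * hi
  refine ⟨shiftDerivation g e hsat, shiftDerivation_locallyNilpotent g e hsat hweight_sat,
    shiftDerivation_isHomogeneousOfDegree g hsat, fun f ↦ ?_⟩
  induction f using induction_linear with
  | zero => simp
  | add x y hx hy => simp only [map_add, hx, hy]
  | single a c =>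
    have hc : single a c = c • single a (1 : ℂ) := by simp
    rw [hc, map_smul, Derivation.map_smul, D.map_smul, map_smul, hι', hD, shiftDerivation_single, one_smul,
      map_smul, AddSubmonoid.coe_inclusion]
    by_cases hga : g a = 0
    · rw [hga, zero_smul, zero_smul]
    · have hae := hS a a.2 hga
      rw [truncatedMonomial_of_mem S hae, hι',
        truncatedMonomial_of_mem _ (le_saturation S hae)]
      rfl
end

section
/- Let B be a commutative ℂ-algebra, let (𝔞_i)_{i ∈ ℕ} be a decreasing sequence of ideals of B (𝔞_0 ⊇ 𝔞_1 ⊇ ⋯), and let D be a ℂ-derivation on B that is continuous with respect to the linear topology defined by (𝔞_i), i.e., for every i there exists j with D(𝔞_j) ⊆ 𝔞_i. Then the following are equivalent: (1) for every f ∈ B and every i ∈ ℕ there exist n₀, j ∈ ℕ such that D^[n](g) ∈ 𝔞_i for every g with g − f ∈ 𝔞_j and every n ≥ n₀ (topological integrability); (2) both (P1): for every f ∈ B and every i ∈ ℕ there exists n₀ with D^[n](f) ∈ 𝔞_i for all n ≥ n₀, and (P2): for every i ∈ ℕ there exists j ∈ ℕ such that D^[n](𝔞_j) ⊆ 𝔞_i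 for all n ∈ ℕ. -/
/-- If `T` is continuous at `0` for the filtration `𝔞`, its first `n` iterates are
equicontinuous at `0`. -/
theorem exists_forall_lt_iterate_mem {B : Type*} [CommRing B] {𝔞 : ℕ → Ideal B}
    (hanti : ∀ i j : ℕ, i ≤ j → 𝔞 j ≤ 𝔞 i) {T : B → B}
    (hcont : ∀ i : ℕ, ∃ j : ℕ, ∀ f ∈ 𝔞 j, T f ∈ 𝔞 i) (n i : ℕ) :
    ∃ j : ℕ, ∀ m < n, ∀ f ∈ 𝔞 j, T^[m] f ∈ 𝔞 i := by
  induction n with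
  | zero => exact ⟨0, fun m hm => absurd hm m.not_lt_zero⟩
  | succ n ih =>
    obtain ⟨j, hj⟩ := ih
    obtain ⟨k, hk⟩ := hcont j
    refine ⟨max i k, fun m hm f hf => ?_⟩
    cases m with
    | zero => exact hanti _ _ (le_max_left i k) hf
    | succ m =>
      rw [Function.iterate_succ_apply]
      exact hj m (Nat.lt_of_succ_lt_succ hm) _ (hk f (hanti _ _ (le_max_right i k) hf))

/-- For a commutative ℂ-algebra `B`, a decreasing sequence of ideals
`(𝔞_i)` and a ℂ-derivation `D` continuous for the associated linear topology,
topological integrability (continuous convergence of the iterates of `D` to `0`) is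
equivalent to the conjunction of (P1) and (P2). -/
theorem stmt_18 (B : Type) [CommRing B] [Algebra ℂ B]
    (𝔞 : ℕ → Ideal B) (hanti : ∀ i j : ℕ, i ≤ j → 𝔞 j ≤ 𝔞 i)
    (D : Derivation ℂ B B)
    (hcont : ∀ i : ℕ, ∃ j : ℕ, ∀ f ∈ 𝔞 j, D f ∈ 𝔞 i) :
    (∀ f : B, ∀ i : ℕ, ∃ n₀ j : ℕ, ∀ g : B, g - f ∈ 𝔞 j →
        ∀ m : ℕ, n₀ ≤ m → (⇑D)^[m] g ∈ 𝔞 i) ↔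
    ((∀ f : B, ∀ i : ℕ, ∃ n₀ : ℕ, ∀ m : ℕ, n₀ ≤ m → (⇑D)^[m] f ∈ 𝔞 i) ∧
     (∀ i : ℕ, ∃ j : ℕ, ∀ m : ℕ, ∀ f ∈ 𝔞 j, (⇑D)^[m] f ∈ 𝔞 i)) := by
  constructor
  · intro h
    refine ⟨fun f i => ?_, fun i => ?_⟩
    · obtain ⟨n₀, j, hj⟩ := h f i
      exact ⟨n₀, hj f (by simp)⟩
    · obtain ⟨n₀, j, hj⟩ := h 0 i
      obtain ⟨k, hk⟩ := exists_forall_lt_iterate_mem hanti hcont n₀ i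
      refine ⟨max j k, fun m f hf => ?_⟩
      rcases lt_or_ge m n₀ with hm | hm
      · exact hk m hm f (hanti _ _ (le_max_right j k) hf)
      · exact hj f (by simpa using hanti _ _ (le_max_left j k) hf) m hm
  · rintro ⟨h1, h2⟩ f i
    obtain ⟨n₀, hn⟩ := h1 f i
    obtain ⟨j, hj⟩ := h2 i
    refine ⟨n₀, j, fun g hg m hm => ?_⟩
    have hsum := (𝔞 i).add_mem (hj m _ hg) (hn m hm)
    rwa [← iterate_map_add, sub_add_cancel] at hsum
end

section
/- Let S be a pointed affine semigroup and let D be a nonzero locally nilpotent ℂ-derivation on ℂ[S] that is homogeneous of degree e ∈ ℤ^n. If −e ∈ S, then −e is an irreducible element of S: whenever −e = b + c with b, c ∈ S, one has b = 0 or c = 0. -/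
namespace Derivation

variable {R M : Type*} [CommSemiring R] [AddCommMonoid M]

theorem addMonoidAlgebra_single (D : Derivation R (AddMonoidAlgebra R M) (AddMonoidAlgebra R M))
    (a : M) (r : R) :
    D (AddMonoidAlgebra.single a r) = r • D (AddMonoidAlgebra.single a 1) := by
  rw [← map_smul, AddMonoidAlgebra.smul_single, smul_eq_mul, mul_one]

theorem addMonoidAlgebra_single_add
    (D : Derivation R (AddMonoidAlgebra R M) (AddMonoidAlgebra R M)) (a b : M) :
    D (AddMonoidAlgebra.single (a + b) 1) =
      AddMonoidAlgebra.single a 1 * D (AddMonoidAlgebra.single b 1) +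
        AddMonoidAlgebra.single b 1 * D (AddMonoidAlgebra.single a 1) := by
  have h : (AddMonoidAlgebra.single (a + b) 1 : AddMonoidAlgebra R M) =
      AddMonoidAlgebra.single a 1 * AddMonoidAlgebra.single b 1 := by
    rw [AddMonoidAlgebra.single_mul_single, mul_one]
  rw [h, D.leibniz, smul_eq_mul, smul_eq_mul]

theorem eq_zero_of_addMonoidAlgebra_single
    (D : Derivation R (AddMonoidAlgebra R M) (AddMonoidAlgebra R M))
    (h : ∀ a, D (AddMonoidAlgebra.single a 1) = 0) : D = 0 := by
  ext1 f
  induction f using AddMonoidAlgebra.induction_linear with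
  | zero => simp
  | add f g hf hg => simp [hf, hg]
  | single a r => rw [addMonoidAlgebra_single, h, smul_zero, zero_apply]

end Derivation

namespace IsHomogeneousOfDegree

variable {n : ℕ} {S : AddSubmonoid (Fin n → ℤ)}
  {D : Derivation ℂ (AddMonoidAlgebra ℂ S) (AddMonoidAlgebra ℂ S)} {e : Fin n → ℤ}

/-- If `-e = b + c` in a pointed `S` and `c ≠ 0`, then `D` kills `χ^b`. -/
theorem apply_single_eq_zero (hhom : IsHomogeneousOfDegree S D e)
    (hpointed : ∀ a b : S, a + b = 0 → a = 0 ∧ b = 0) {b c : S}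
    (hbc : (b : Fin n → ℤ) + (c : Fin n → ℤ) = -e) (hc : c ≠ 0) :
    D (AddMonoidAlgebra.single b 1) = 0 := by
  refine (hhom b).2 fun h => hc (hpointed ⟨_, h⟩ c ?_).2
  apply Subtype.ext
  change (b : Fin n → ℤ) + e + c = 0
  rw [add_right_comm, hbc, neg_add_cancel]

theorem exists_apply_single_eq (hhom : IsHomogeneousOfDegree S D e) (he : -e ∈ S)
    (hD : D (AddMonoidAlgebra.single (⟨-e, he⟩ : S) 1) = 0) {a : S}
    (ha : D (AddMonoidAlgebra.single a 1) ≠ 0) :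
    ∃ (a' : S) (r : ℂ), r ≠ 0 ∧ D (AddMonoidAlgebra.single a 1) = AddMonoidAlgebra.single a' r ∧
      D (AddMonoidAlgebra.single a' 1) ≠ 0 := by
  have h : (a : Fin n → ℤ) + e ∈ S := by_contra fun h => ha ((hhom a).2 h)
  obtain ⟨r, hr⟩ := (hhom a).1 h
  refine ⟨⟨_, h⟩, r, ?_, hr, fun h0 => ha ?_⟩
  · rintro rfl
    exact ha (hr.trans (AddMonoidAlgebra.single_zero _))
  · have key : a = ⟨_, h⟩ + ⟨-e, he⟩ := Subtype.ext (add_neg_cancel_right _ _).symm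
    rw [key, D.addMonoidAlgebra_single_add, h0, hD, mul_zero, mul_zero, add_zero]

theorem iterate_single_ne_zero (hhom : IsHomogeneousOfDegree S D e) (he : -e ∈ S)
    (hD : D (AddMonoidAlgebra.single (⟨-e, he⟩ : S) 1) = 0) (m : ℕ) {a : S} {r : ℂ}
    (hr : r ≠ 0) (ha : D (AddMonoidAlgebra.single a 1) ≠ 0) :
    (⇑D)^[m] (AddMonoidAlgebra.single a r) ≠ 0 := by
  induction m generalizing a r with
  | zero => simpa using hr
  | succ m ih =>
    obtain ⟨a', s, hs, has, ha'⟩ := hhom.exists_apply_single_eq he hD ha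
    rw [Function.iterate_succ_apply, D.addMonoidAlgebra_single, has,
      AddMonoidAlgebra.smul_single, smul_eq_mul]
    exact ih (mul_ne_zero hr hs) ha'

end IsHomogeneousOfDegree

/-- If `D` is a nonzero homogeneous locally nilpotent derivation of degree
`e` on `ℂ[S]` for a pointed affine semigroup `S`, and `−e ∈ S`, then `−e` is irreducible
in `S`: any decomposition `−e = b + c` with `b, c ∈ S` has `b = 0` or `c = 0`. -/
theorem stmt_19 {n : ℕ} (S : AddSubmonoid (Fin n → ℤ)) (hfg : S.FG)
    (hpointed : ∀ a b : S, a + b = 0 → a = 0 ∧ b = 0)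
    (D : Derivation ℂ (AddMonoidAlgebra ℂ S) (AddMonoidAlgebra ℂ S))
    (hD0 : D ≠ 0)
    (hlnd : ∀ f : AddMonoidAlgebra ℂ S, ∃ m : ℕ, (⇑D)^[m] f = 0)
    (e : Fin n → ℤ) (hhom : IsHomogeneousOfDegree S D e)
    (he : -e ∈ S) :
    ∀ b c : S, (b : Fin n → ℤ) + (c : Fin n → ℤ) = -e → b = 0 ∨ c = 0 := by
  intro b c hbc
  by_contra! h
  obtain ⟨hb, hc⟩ := h
  have hD : D (AddMonoidAlgebra.single (⟨-e, he⟩ : S) 1) = 0 := by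
    have key : (⟨-e, he⟩ : S) = b + c := Subtype.ext hbc.symm
    rw [key, D.addMonoidAlgebra_single_add, hhom.apply_single_eq_zero hpointed hbc hc,
      hhom.apply_single_eq_zero hpointed ((add_comm _ _).trans hbc) hb, mul_zero, mul_zero,
      add_zero]
  refine hD0 (D.eq_zero_of_addMonoidAlgebra_single fun a => by_contra fun ha => ?_)
  obtain ⟨m, hm⟩ := hlnd (AddMonoidAlgebra.single a 1)
  exact hhom.iterate_single_ne_zero he hD m one_ne_zero ha hm
end
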